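/- arXiv:2003.06976 — 2 statements merged into one kernel-verified Lean document; each statement's English description precedes it below -/
import Mathlib

section
/- Let V be a finite-dimensional real normed vector space, B a symmetric bilinear form on V, and T : V → V a linear map preserving B (B(Tv,Tw) = B(v,w) for all v,w). Suppose h > 0 and there are vectors η₊, η₋ ∈ V with Tη₊ = e^{h}•η₊, Tη₋ = e^{-h}•η₋, B(η₊, η₋) = 1, and suppose that B is negative definite on the subspace W = {w ∈ V | B(w, η₊) = 0 and B(w, η₋) = 0}. Then for every v ∈ V, the sequence e^{-nh}•(Tⁿ v) converges to B(v, η₋)•η₊ as n → ∞. -/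
/-- A bilinear form that is positive definite on a subspace of a finite-dimensional normed space
is bounded below there by a positive multiple of the squared norm. -/
theorem exists_pos_mul_norm_sq_le_of_posDef_on {V : Type*} [NormedAddCommGroup V]
    [NormedSpace ℝ V] [FiniteDimensional ℝ V] (B : V →ₗ[ℝ] V →ₗ[ℝ] ℝ) (W : Submodule ℝ V)
    (hB : ∀ w ∈ W, w ≠ 0 → 0 < B w w) :
    ∃ c : ℝ, 0 < c ∧ ∀ w ∈ W, c * ‖w‖ ^ 2 ≤ B w w := by
  have hcont : Continuous fun v : V => B v v := by
    have h1 : Continuous (fun v : V => LinearMap.toContinuousLinearMap (B v)) :=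
      LinearMap.continuous_of_finiteDimensional (LinearMap.toContinuousLinearMap.toLinearMap ∘ₗ B)
    exact h1.clm_apply continuous_id
  have : ProperSpace V := FiniteDimensional.proper ℝ V
  have hS : IsCompact (Metric.sphere (0 : V) 1 ∩ W) :=
    (isCompact_sphere 0 1).inter_right W.closed_of_finiteDimensional
  obtain ⟨c, hc, hcS⟩ := hS.exists_forall_le' hcont.continuousOn (a := 0) fun w hw =>
    hB w hw.2 (ne_zero_of_mem_unit_sphere ⟨w, hw.1⟩)
  refine ⟨c, hc, fun w hw => ?_⟩
  rcases eq_or_ne w 0 with rfl | hw0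
  · simp
  have hn : 0 < ‖w‖ := norm_pos_iff.2 hw0
  have hle := hcS (‖w‖⁻¹ • w) ⟨by simp [norm_smul, hn.ne'], W.smul_mem _ hw⟩
  simp only [map_smul, LinearMap.smul_apply, smul_eq_mul] at hle
  calc c * ‖w‖ ^ 2 ≤ (‖w‖⁻¹ * (‖w‖⁻¹ * B w w)) * ‖w‖ ^ 2 := by gcongr
    _ = B w w := by field_simp

/-- The iterates of a linear map scale an eigenvector by the powers of the eigenvalue. -/
theorem pow_apply_of_apply_eq_smul {R M : Type*} [CommSemiring R] [AddCommMonoid M] [Module R M]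
    {T : M →ₗ[R] M} {a : R} {x : M} (hx : T x = a • x) (n : ℕ) : (T ^ n) x = a ^ n • x := by
  induction n with
  | zero => simp
  | succ n ih => rw [pow_succ', Module.End.mul_apply, ih, map_smul, hx, smul_smul, pow_succ]

/-- An eigenvector of an isometry of a bilinear form is isotropic if the square of its eigenvalue
is not `1`. -/
theorem apply_self_eq_zero_of_apply_eq_smul {K M : Type*} [Field K] [AddCommGroup M] [Module K M]
    {B : M →ₗ[K] M →ₗ[K] K} {T : M →ₗ[K] M} (hT : ∀ v w, B (T v) (T w) = B v w)
    {a : K} (ha : a * a ≠ 1) {x : M} (hx : T x = a • x) : B x x = 0 := by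
  have hB := hT x x
  simp only [hx, map_smul, LinearMap.smul_apply, smul_eq_mul] at hB
  have : (a * a - 1) * B x x = 0 := by linear_combination hB
  exact (mul_eq_zero.1 this).resolve_left (sub_ne_zero.2 ha)

/-- An isometry of a bilinear form preserves the orthogonal complement of an eigenvector with
non-zero eigenvalue. -/
theorem apply_apply_eq_zero_of_apply_eq_smul {K M : Type*} [Field K] [AddCommGroup M] [Module K M]
    {B : M →ₗ[K] M →ₗ[K] K} {T : M →ₗ[K] M} (hT : ∀ v w, B (T v) (T w) = B v w)
    {a : K} (ha : a ≠ 0) {x : M} (hx : T x = a • x) {w : M} (hw : B w x = 0) :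
    B (T w) x = 0 := by
  have hB := hT w x
  rw [hx, map_smul, hw, smul_eq_mul] at hB
  exact (mul_eq_zero.1 hB).resolve_left ha

/-- Convergence `e^{-nh} Tⁿ v → B(v,η₋) η₊` for a linear map preserving a symmetric bilinear
form with eigenvectors `η₊, η₋` of eigenvalues `e^h, e^{-h}`, `B(η₊,η₋) = 1`, and `B` negative
definite on the `B`-orthogonal complement of `η₊, η₋`. -/
theorem stmt_2 (V : Type*) [NormedAddCommGroup V] [NormedSpace ℝ V] [FiniteDimensional ℝ V]
    (B : V →ₗ[ℝ] V →ₗ[ℝ] ℝ) (hBsymm : ∀ v w : V, B v w = B w v)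
    (T : V →ₗ[ℝ] V) (hT : ∀ v w : V, B (T v) (T w) = B v w)
    (h : ℝ) (hh : 0 < h) (ηp ηm : V)
    (hηp : T ηp = Real.exp h • ηp) (hηm : T ηm = Real.exp (-h) • ηm)
    (hpair : B ηp ηm = 1)
    (hneg : ∀ w : V, w ≠ 0 → B w ηp = 0 → B w ηm = 0 → B w w < 0) :
    ∀ v : V, Filter.Tendsto (fun n : ℕ => Real.exp (-(n * h)) • (T ^ n) v)
      Filter.atTop (nhds (B v ηm • ηp)) := by
  intro v
  have hpp : B ηp ηp = 0 := apply_self_eq_zero_of_apply_eq_smul hT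
    (by rw [← Real.exp_add, Ne, Real.exp_eq_one_iff]; linarith) hηp
  have hmm : B ηm ηm = 0 := apply_self_eq_zero_of_apply_eq_smul hT
    (by rw [← Real.exp_add, Ne, Real.exp_eq_one_iff]; linarith) hηm
  have hmp : B ηm ηp = 1 := by rw [hBsymm, hpair]
  let W : Submodule ℝ V := LinearMap.ker (B.flip ηp) ⊓ LinearMap.ker (B.flip ηm)
  have hW : ∀ w, w ∈ W ↔ B w ηp = 0 ∧ B w ηm = 0 := fun w => by simp [W]
  obtain ⟨c, hc, hcW⟩ := exists_pos_mul_norm_sq_le_of_posDef_on (-B) W fun w hw hw0 => by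
    simpa using hneg w hw0 ((hW w).1 hw).1 ((hW w).1 hw).2
  obtain ⟨w, hw⟩ : ∃ w, w = v - B v ηm • ηp - B v ηp • ηm := ⟨_, rfl⟩
  have hwW : w ∈ W := by
    rw [hW, hw]
    constructor <;> simp [hpp, hmm, hmp, hpair]
  have hTW : ∀ n : ℕ, (T ^ n) w ∈ W ∧ B ((T ^ n) w) ((T ^ n) w) = B w w := by
    intro n
    induction n with
    | zero => simpa using hwW
    | succ n ih =>
      rw [pow_succ', Module.End.mul_apply, hT]
      have hmem := (hW _).1 ih.1
      exact ⟨(hW _).2 ⟨apply_apply_eq_zero_of_apply_eq_smul hT (Real.exp_ne_zero _) hηp hmem.1,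
        apply_apply_eq_zero_of_apply_eq_smul hT (Real.exp_ne_zero _) hηm hmem.2⟩, ih.2⟩
  have hexp : ∀ n : ℕ, Real.exp (-(n * h)) = Real.exp (-h) ^ n := fun n => by
    rw [← Real.exp_nat_mul, mul_neg]
  have hlim : Filter.Tendsto (fun n : ℕ => Real.exp (-h) ^ n) Filter.atTop (nhds 0) :=
    tendsto_pow_atTop_nhds_zero_of_lt_one (Real.exp_pos _).le (Real.exp_lt_one_iff.2 (by linarith))
  have hwlim : Filter.Tendsto (fun n : ℕ => Real.exp (-h) ^ n • (T ^ n) w) Filter.atTop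
      (nhds 0) := by
    refine hlim.zero_smul_isBoundedUnder_le ?_
    refine Filter.isBoundedUnder_of ⟨√(-B w w / c), fun n => Real.le_sqrt_of_sq_le ?_⟩
    rw [le_div_iff₀' hc]
    simpa [(hTW n).2] using hcW _ (hTW n).1
  have hsum := (hwlim.add (tendsto_const_nhds (x := B v ηm • ηp))).add
    (((hlim.mul hlim).mul_const (B v ηp)).smul_const ηm)
  simp only [zero_add, mul_zero, zero_mul, zero_smul, add_zero] at hsum
  refine hsum.congr fun n => ?_
  have hv : v = w + B v ηm • ηp + B v ηp • ηm := by rw [hw]; abel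
  have hinv : Real.exp (-h) ^ n * Real.exp h ^ n = 1 := by
    rw [← mul_pow, ← Real.exp_add, neg_add_cancel, Real.exp_zero, one_pow]
  conv_rhs => rw [hv]
  simp only [map_add, map_smul, pow_apply_of_apply_eq_smul hηp, pow_apply_of_apply_eq_smul hηm,
    hexp, smul_add, smul_smul]
  congr 1
  · congr 2
    linear_combination (-B v ηm) * hinv
  · congr 1
    ring
end

section
/- Let (X, μ) be a probability measure space, let f : X → ℝ be integrable with f(x) ≥ 0 for μ-almost every x, and let c ≥ 0 be a real number with ∫ f dμ ≥ c. If moreover ∫ log(e^{2f(x)} + e^{-2f(x)}) dμ(x) ≤ log(e^{2c} + e^{-2c}), then f = c μ-almost everywhere. -/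
open MeasureTheory

theorem Real.hasDerivAt_log_exp_add_exp_neg (t : ℝ) :
    HasDerivAt (fun t : ℝ => Real.log (Real.exp (2 * t) + Real.exp (-(2 * t))))
      (2 * (Real.exp (2 * t) - Real.exp (-(2 * t))) /
        (Real.exp (2 * t) + Real.exp (-(2 * t)))) t := by
  have h1 : HasDerivAt (fun t : ℝ => 2 * t) 2 t := by
    simpa using (hasDerivAt_id t).const_mul (2 : ℝ)
  convert (h1.exp.fun_add h1.fun_neg.exp).log (by positivity) using 1
  ring

theorem Real.strictConvexOn_log_exp_add_exp_neg :
    StrictConvexOn ℝ Set.univ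
      (fun t : ℝ => Real.log (Real.exp (2 * t) + Real.exp (-(2 * t)))) := by
  refine StrictMono.strictConvexOn_univ_of_deriv
    (continuous_iff_continuousAt.2 fun t => (hasDerivAt_log_exp_add_exp_neg t).continuousAt) ?_
  intro a b hab
  rw [(hasDerivAt_log_exp_add_exp_neg a).deriv, (hasDerivAt_log_exp_add_exp_neg b).deriv,
    div_lt_div_iff₀ (by positivity) (by positivity)]
  have h : Real.exp (2 * a) * Real.exp (-(2 * b)) < Real.exp (2 * b) * Real.exp (-(2 * a)) := by
    rw [← Real.exp_add, ← Real.exp_add, Real.exp_lt_exp]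
    linarith
  nlinarith

theorem Real.strictMonoOn_log_exp_add_exp_neg :
    StrictMonoOn (fun t : ℝ => Real.log (Real.exp (2 * t) + Real.exp (-(2 * t))))
      (Set.Ici 0) := by
  intro a ha b hb hab
  rw [Set.mem_Ici] at ha hb
  have h : Real.cosh (2 * a) < Real.cosh (2 * b) := by
    rw [Real.cosh_lt_cosh, abs_of_nonneg (by positivity), abs_of_nonneg (by positivity)]
    linarith
  rw [Real.cosh_eq, Real.cosh_eq] at h
  exact Real.log_lt_log (by positivity) (by linarith)

theorem Real.abs_log_exp_add_exp_neg_le (t : ℝ) :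
    |Real.log (Real.exp (2 * t) + Real.exp (-(2 * t)))| ≤ Real.log 2 + 2 * |t| := by
  have h1 : 1 ≤ Real.exp (2 * t) + Real.exp (-(2 * t)) := by
    have := Real.one_le_cosh (2 * t)
    rw [Real.cosh_eq] at this
    linarith
  have h2 : Real.exp (2 * t) ≤ Real.exp (2 * |t|) :=
    Real.exp_le_exp.2 (by linarith [le_abs_self t])
  have h3 : Real.exp (-(2 * t)) ≤ Real.exp (2 * |t|) :=
    Real.exp_le_exp.2 (by linarith [neg_le_abs t])
  rw [abs_of_nonneg (Real.log_nonneg h1), ← Real.log_exp (2 * |t|),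
    ← Real.log_mul (by norm_num) (by positivity)]
  exact Real.log_le_log (by positivity) (by linarith)

/-- Equality case: if `f ≥ 0` a.e. is integrable on a probability space with `∫ f ≥ c ≥ 0`
and `∫ log(e^{2f} + e^{-2f}) ≤ log(e^{2c} + e^{-2c})`, then `f = c` almost everywhere. -/
theorem stmt_6 {X : Type*} [MeasurableSpace X] (μ : Measure X) [IsProbabilityMeasure μ]
    (f : X → ℝ) (hf : Integrable f μ) (hf0 : ∀ᵐ x ∂μ, 0 ≤ f x)
    (c : ℝ) (hc : 0 ≤ c) (hfc : c ≤ ∫ x, f x ∂μ)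
    (heq : ∫ x, Real.log (Real.exp (2 * f x) + Real.exp (-(2 * f x))) ∂μ ≤
      Real.log (Real.exp (2 * c) + Real.exp (-(2 * c)))) :
    ∀ᵐ x ∂μ, f x = c := by
  have hcont : Continuous (fun t : ℝ => Real.log (Real.exp (2 * t) + Real.exp (-(2 * t)))) :=
    continuous_iff_continuousAt.2 fun t => (Real.hasDerivAt_log_exp_add_exp_neg t).continuousAt
  have hint : Integrable
      ((fun t : ℝ => Real.log (Real.exp (2 * t) + Real.exp (-(2 * t)))) ∘ f) μ :=
    ((integrable_const (Real.log 2)).add (hf.abs.const_mul 2)).mono'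
      (hcont.comp_aestronglyMeasurable hf.aestronglyMeasurable)
      (ae_of_all _ fun x => Real.abs_log_exp_add_exp_neg_le (f x))
  have hmono := Real.strictMonoOn_log_exp_add_exp_neg.monotoneOn hc (hc.trans hfc) hfc
  rcases Real.strictConvexOn_log_exp_add_exp_neg.ae_eq_const_or_map_average_lt
    hcont.continuousOn isClosed_univ (by simp) hf hint with h | h
  · rw [average_eq_integral] at h
    have hI : ∫ x, Real.log (Real.exp (2 * f x) + Real.exp (-(2 * f x))) ∂μ =
        Real.log (Real.exp (2 * ∫ x, f x ∂μ) + Real.exp (-(2 * ∫ x, f x ∂μ))) := by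
      rw [integral_congr_ae (h.mono fun x hx => by simp only [hx, Function.const_apply]; rfl)]
      simp
    rw [hI] at heq
    have hle : ∫ x, f x ∂μ ≤ c :=
      (Real.strictMonoOn_log_exp_add_exp_neg.le_iff_le (hc.trans hfc) hc).1 heq
    filter_upwards [h] with x hx
    rw [hx, Function.const_apply, le_antisymm hle hfc]
  · simp only [average_eq_integral] at h
    exact absurd (h.trans_le heq) hmono.not_gt
end
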